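/- With the standing setup, for each 1 ≤ i ≤ m the permutation u_i is the minimum element of the block [u,v]^{(i)} in the Bruhat order; that is, u_i ∈ [u,v]^{(i)} and u_i ≤ w for all w ∈ [u,v]^{(i)}. -/

import Mathlib

open Equiv Finset Polynomial

/-- The odd diagram of a permutation of `Fin n` (0-based positions and values):
boxes `(i, j)` with `w i > j`, `i < w⁻¹ j`, and `i`, `w⁻¹ j` of different parity. -/
def oddDiagram {n : ℕ} (w : Equiv.Perm (Fin n)) : Set (Fin n × Fin n) :=
  {p | p.2 < w p.1 ∧ p.1 < w⁻¹ p.2 ∧ ((p.1 : ℕ) % 2 ≠ ((w⁻¹ p.2 : Fin n) : ℕ) % 2)}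

/-- The Bruhat order on `S_n`: the reflexive-transitive closure of the relations
`x < x * (i j)` whenever `i < j` and `x i < x j`. -/
def bruhatLE {n : ℕ} : Equiv.Perm (Fin n) → Equiv.Perm (Fin n) → Prop :=
  Relation.ReflTransGen (fun x y => ∃ i j : Fin n, i < j ∧ x i < x j ∧ y = x * Equiv.swap i j)

/-- Strict Bruhat order. -/
def bruhatLT {n : ℕ} (x y : Equiv.Perm (Fin n)) : Prop := bruhatLE x y ∧ x ≠ y

/-- The Coxeter length of a permutation, i.e. its number of inversions. -/
def invLength {n : ℕ} (w : Equiv.Perm (Fin n)) : ℕ :=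
  (Finset.univ.filter (fun p : Fin n × Fin n => p.1 < p.2 ∧ w p.2 < w p.1)).card

/-- The number of positions below `p` at which `x` takes a value below `q`. -/
def rankCount {n : ℕ} (x : Equiv.Perm (Fin n)) (p q : ℕ) : ℕ :=
  ∑ l : Fin n, if (l : ℕ) < p ∧ (x l : ℕ) < q then 1 else 0

theorem rankCount_rectangle {n : ℕ} (x : Equiv.Perm (Fin n)) {p p' q q' : ℕ}
    (hp : p ≤ p') (hq : q ≤ q') :
    rankCount x p' q' + rankCount x p q = rankCount x p q' + rankCount x p' q +
      ∑ l : Fin n, if p ≤ (l : ℕ) ∧ (l : ℕ) < p' ∧ q ≤ (x l : ℕ) ∧ (x l : ℕ) < q'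
        then 1 else 0 := by
  unfold rankCount
  simp only [← Finset.sum_add_distrib]
  refine Finset.sum_congr rfl fun l _ => ?_
  split_ifs <;> omega

theorem rankCount_rectangle_eq {n : ℕ} (x : Equiv.Perm (Fin n)) {p p' q q' : ℕ}
    (hp : p ≤ p') (hq : q ≤ q')
    (h : ∀ l : Fin n, p ≤ (l : ℕ) → (l : ℕ) < p' → q ≤ (x l : ℕ) → ¬ (x l : ℕ) < q') :
    rankCount x p' q' + rankCount x p q = rankCount x p q' + rankCount x p' q := by
  rw [rankCount_rectangle x hp hq, Finset.sum_eq_zero, add_zero]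
  exact fun l _ => if_neg fun hl => h l hl.1 hl.2.1 hl.2.2.1 hl.2.2.2

theorem rankCount_rectangle_lt {n : ℕ} (x : Equiv.Perm (Fin n)) {p p' q q' : ℕ}
    (l : Fin n) (hpl : p ≤ (l : ℕ)) (hlp : (l : ℕ) < p') (hql : q ≤ (x l : ℕ))
    (hlq : (x l : ℕ) < q') :
    rankCount x p q' + rankCount x p' q < rankCount x p' q' + rankCount x p q := by
  rw [rankCount_rectangle x (hpl.trans hlp.le) (hql.trans hlq.le)]
  refine Nat.lt_add_of_pos_right (Finset.sum_pos' (fun _ _ => Nat.zero_le _) ⟨l, by simp, ?_⟩)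
  rw [if_pos ⟨hpl, hlp, hql, hlq⟩]
  exact Nat.one_pos

theorem rankCount_zero_left {n : ℕ} (x : Equiv.Perm (Fin n)) (q : ℕ) : rankCount x 0 q = 0 := by
  simp [rankCount]

theorem rankCount_zero_right {n : ℕ} (x : Equiv.Perm (Fin n)) (p : ℕ) : rankCount x p 0 = 0 := by
  simp [rankCount]

theorem rankCount_congr {n : ℕ} {x y : Equiv.Perm (Fin n)} {p q : ℕ}
    (h : ∀ l : Fin n, (l : ℕ) < p → ((x l : ℕ) < q ↔ (y l : ℕ) < q)) :
    rankCount x p q = rankCount y p q := by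
  refine Finset.sum_congr rfl fun l _ => if_congr ?_ rfl rfl
  exact and_congr_right (h l)

theorem rankCount_mul_swap {n : ℕ} (x : Equiv.Perm (Fin n)) {i j : Fin n} (hij : i < j)
    (hx : x i < x j) (p q : ℕ) :
    rankCount (x * Equiv.swap i j) p q +
      (if (i : ℕ) < p ∧ p ≤ (j : ℕ) ∧ (x i : ℕ) < q ∧ q ≤ (x j : ℕ) then 1 else 0) =
      rankCount x p q := by
  have hj : j ∈ Finset.univ.erase i := by simp [hij.ne']
  have hi := Finset.mem_univ i
  unfold rankCount
  rw [← Finset.add_sum_erase _ _ hi, ← Finset.add_sum_erase _ _ hj,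
    ← Finset.add_sum_erase _ (fun l : Fin n => if (l : ℕ) < p ∧ (x l : ℕ) < q then 1 else 0) hi,
    ← Finset.add_sum_erase _ (fun l : Fin n => if (l : ℕ) < p ∧ (x l : ℕ) < q then 1 else 0) hj]
  have hrest : ∀ l ∈ (Finset.univ.erase i).erase j,
      (if (l : ℕ) < p ∧ ((x * Equiv.swap i j) l : ℕ) < q then 1 else 0) =
        if (l : ℕ) < p ∧ (x l : ℕ) < q then 1 else 0 := by
    intro l hl
    simp only [Finset.mem_erase, Finset.mem_univ, and_true] at hl
    rw [Equiv.Perm.mul_apply, Equiv.swap_apply_of_ne_of_ne hl.2 hl.1]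
  rw [Finset.sum_congr rfl hrest]
  simp only [Equiv.Perm.mul_apply, Equiv.swap_apply_left, Equiv.swap_apply_right]
  rw [Fin.lt_def] at hij hx
  split_ifs <;> omega

theorem rankCount_le_of_bruhatLE {n : ℕ} {x y : Equiv.Perm (Fin n)} (h : bruhatLE x y)
    (p q : ℕ) : rankCount y p q ≤ rankCount x p q := by
  induction h with
  | refl => exact le_rfl
  | tail _ hstep ih =>
    obtain ⟨i, j, hij, hx, rfl⟩ := hstep
    have := rankCount_mul_swap _ hij hx p q
    omega

theorem bruhatLE_mul_swap {n : ℕ} (x : Equiv.Perm (Fin n)) {i j : Fin n} (hij : i < j)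
    (hx : x i < x j) : bruhatLE x (x * Equiv.swap i j) :=
  Relation.ReflTransGen.single ⟨i, j, hij, hx, rfl⟩

theorem not_bruhatLE_of_mul_swap {n : ℕ} (x : Equiv.Perm (Fin n)) {i j : Fin n} (hij : i < j)
    (hx : x i < x j) : ¬ bruhatLE (x * Equiv.swap i j) x := by
  intro h
  have h1 := rankCount_le_of_bruhatLE h (i + 1) (x i + 1)
  have h2 := rankCount_mul_swap x hij hx (i + 1) (x i + 1)
  rw [if_pos (by rw [Fin.lt_def] at hij hx; omega)] at h2
  omega

/-- If `x` dominates `y` in rank and differs from it, then some transposition raises `x` in the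
Bruhat order while preserving the domination. -/
theorem exists_swap_rankCount_le {n : ℕ} {x y : Equiv.Perm (Fin n)}
    (h : ∀ p q, rankCount y p q ≤ rankCount x p q) (hne : x ≠ y) :
    ∃ i j : Fin n, i < j ∧ x i < x j ∧
      ∀ p q, rankCount y p q ≤ rankCount (x * Equiv.swap i j) p q := by
  obtain ⟨i, hi, hmin⟩ : ∃ i : Fin n, x i ≠ y i ∧ ∀ l < i, x l = y l := by
    have hex : ∃ i : Fin n, x i ≠ y i := by
      by_contra! hc
      exact hne (Equiv.ext hc)
    refine ⟨WellFounded.min wellFounded_lt {i | x i ≠ y i} hex,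
      WellFounded.min_mem wellFounded_lt {i | x i ≠ y i} hex, fun l hl => ?_⟩
    by_contra hc
    exact WellFounded.not_lt_min wellFounded_lt {i | x i ≠ y i} hc hl
  have hprefix : ∀ q, rankCount x i q = rankCount y i q := fun q =>
    rankCount_congr fun l hl => by rw [hmin l hl]
  have hlt : x i < y i := by
    by_contra hc
    have hc' : y i < x i := lt_of_le_of_ne (not_lt.mp hc) (Ne.symm hi)
    have h1 := rankCount_rectangle_lt y (p := i) (p' := i + 1) (q := 0) (q' := y i + 1) i
      le_rfl (Nat.lt_succ_self _) (Nat.zero_le _) (Nat.lt_succ_self _)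
    have h2 := rankCount_rectangle_eq x (p := i) (p' := i + 1) (q := 0) (q' := y i + 1)
      (Nat.le_succ _) (Nat.zero_le _) (by
        intro l hl hl' _
        obtain rfl : l = i := Fin.ext (by omega)
        rw [Fin.lt_def] at hc'
        omega)
    have h3 := h (i + 1) (y i + 1)
    have h4 := hprefix (y i + 1)
    simp only [rankCount_zero_right] at h1 h2
    omega
  obtain ⟨j, ⟨hij, hxij, hxj⟩, hjmin⟩ : ∃ j : Fin n, (i < j ∧ x i < x j ∧ x j ≤ y i) ∧
      ∀ l < j, ¬ (i < l ∧ x i < x l ∧ x l ≤ y i) := by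
    have hex : ∃ j : Fin n, i < j ∧ x i < x j ∧ x j ≤ y i := by
      refine ⟨x⁻¹ (y i), ?_, by simpa using hlt, by simp⟩
      have hx : x (x⁻¹ (y i)) = y i := by simp
      rcases lt_trichotomy (x⁻¹ (y i)) i with hl | hl | hl
      · have := hmin _ hl
        rw [hx] at this
        exact absurd (y.injective this).symm hl.ne
      · rw [hl] at hx
        exact absurd hx hi
      · exact hl
    refine ⟨WellFounded.min wellFounded_lt {j | i < j ∧ x i < x j ∧ x j ≤ y i} hex,
      WellFounded.min_mem wellFounded_lt {j | i < j ∧ x i < x j ∧ x j ≤ y i} hex,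
      fun l hl hc => ?_⟩
    exact WellFounded.not_lt_min wellFounded_lt {j | i < j ∧ x i < x j ∧ x j ≤ y i} hc hl
  refine ⟨i, j, hij, hxij, fun p q => ?_⟩
  have hswap := rankCount_mul_swap x hij hxij p q
  have hpq := h p q
  split_ifs at hswap with hbox
  · obtain ⟨hip, hpj, hxq, hqx⟩ := hbox
    rw [Fin.le_def] at hxj
    have hx := rankCount_rectangle_eq x (p := i) (p' := p) (q := q) (q' := y i + 1)
      hip.le (by omega) (by
        intro l hl hlp hql hlq
        have hli : l ≠ i := by
          rintro rfl
          omega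
        refine hjmin l (Fin.lt_def.mpr (by omega)) ⟨?_, ?_, ?_⟩
        · exact lt_of_le_of_ne hl (Ne.symm hli)
        · exact Fin.lt_def.mpr (by omega)
        · exact Fin.le_def.mpr (by omega))
    have hy := rankCount_rectangle_lt y (p := i) (p' := p) (q := q) (q' := y i + 1) i
      le_rfl hip (by omega) (Nat.lt_succ_self _)
    have h1 := hprefix q
    have h2 := hprefix (y i + 1)
    have h3 := h p (y i + 1)
    omega
  · omega

/-- The rank-matrix criterion for the Bruhat order. -/
theorem bruhatLE_of_rankCount_le {n : ℕ} {x y : Equiv.Perm (Fin n)}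
    (h : ∀ p q, rankCount y p q ≤ rankCount x p q) : bruhatLE x y := by
  induction hN : ∑ p ∈ Finset.range (n + 1), ∑ q ∈ Finset.range (n + 1), rankCount x p q
    using Nat.strong_induction_on generalizing x with
  | _ N ih =>
    by_cases hne : x = y
    · exact hne ▸ Relation.ReflTransGen.refl
    obtain ⟨i, j, hij, hx, hle⟩ := exists_swap_rankCount_le h hne
    refine Relation.ReflTransGen.head ⟨i, j, hij, hx, rfl⟩ (ih _ ?_ hle rfl)
    have hmono : ∀ p q, rankCount (x * Equiv.swap i j) p q ≤ rankCount x p q :=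
      rankCount_le_of_bruhatLE (bruhatLE_mul_swap x hij hx)
    rw [← hN]
    refine Finset.sum_lt_sum (fun p _ => Finset.sum_le_sum fun q _ => hmono p q)
      ⟨i + 1, Finset.mem_range.mpr (by omega), ?_⟩
    refine Finset.sum_lt_sum (fun q _ => hmono _ q)
      ⟨x i + 1, Finset.mem_range.mpr (by omega), ?_⟩
    have hswap := rankCount_mul_swap x hij hx (i + 1) (x i + 1)
    rw [if_pos (by rw [Fin.lt_def] at hij hx; omega)] at hswap
    omega

theorem mem_oddDiagram_apply {n : ℕ} {w : Equiv.Perm (Fin n)} {i l : Fin n} :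
    (i, w l) ∈ oddDiagram w ↔ w l < w i ∧ i < l ∧ (i : ℕ) % 2 ≠ (l : ℕ) % 2 := by
  simp [oddDiagram]

theorem oddDiagram_mul_swap {n : ℕ} (w : Equiv.Perm (Fin n)) {s t : Fin n} (hst : s < t)
    (hw : w s < w t) (hpar : (s : ℕ) % 2 = (t : ℕ) % 2)
    (hbetween : ∀ c, s < c → c < t → (c : ℕ) % 2 ≠ (t : ℕ) % 2 → w c < w s)
    (hafter : ∀ d, t < d → (d : ℕ) % 2 ≠ (t : ℕ) % 2 → w s < w d → w t < w d) :
    oddDiagram (w * Equiv.swap s t) = oddDiagram w := by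
  ext ⟨i, j⟩
  obtain ⟨l, rfl⟩ := w.surjective j
  rw [mem_oddDiagram_apply]
  have hmem : (i, w l) ∈ oddDiagram (w * Equiv.swap s t) ↔
      w l < w (Equiv.swap s t i) ∧ i < Equiv.swap s t l ∧
        (i : ℕ) % 2 ≠ (Equiv.swap s t l : ℕ) % 2 := by
    simp [oddDiagram]
  rw [hmem]
  have hb := hbetween i
  have hb' := hbetween l
  have ha := hafter l
  rw [Fin.lt_def] at hst hw
  by_cases his : i = s
  · subst his
    by_cases hls : l = i
    · subst hls
      simp only [Equiv.swap_apply_left, Fin.lt_def]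
      omega
    by_cases hlt : l = t
    · subst hlt
      simp only [Equiv.swap_apply_left, Equiv.swap_apply_right, Fin.lt_def]
      omega
    rw [Equiv.swap_apply_left, Equiv.swap_apply_of_ne_of_ne hls hlt]
    have h1 : (w l : ℕ) ≠ w i := fun h => hls (w.injective (Fin.ext h))
    have h2 : (w l : ℕ) ≠ w t := fun h => hlt (w.injective (Fin.ext h))
    have h3 : (l : ℕ) ≠ t := fun h => hlt (Fin.ext h)
    simp only [Fin.lt_def] at *
    omega
  by_cases hit : i = t
  · subst hit
    by_cases hls : l = s
    · subst hls
      simp only [Equiv.swap_apply_right, Equiv.swap_apply_left, Fin.lt_def]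
      omega
    by_cases hlt : l = i
    · subst hlt
      simp only [Equiv.swap_apply_right, Fin.lt_def]
      omega
    rw [Equiv.swap_apply_right, Equiv.swap_apply_of_ne_of_ne hls hlt]
    have h1 : (w l : ℕ) ≠ w s := fun h => hls (w.injective (Fin.ext h))
    have h2 : (w l : ℕ) ≠ w i := fun h => hlt (w.injective (Fin.ext h))
    simp only [Fin.lt_def] at *
    omega
  rw [Equiv.swap_apply_of_ne_of_ne his hit]
  have h1 : (i : ℕ) ≠ s := fun h => his (Fin.ext h)
  have h2 : (i : ℕ) ≠ t := fun h => hit (Fin.ext h)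
  by_cases hls : l = s
  · subst hls
    rw [Equiv.swap_apply_left]
    simp only [Fin.lt_def] at *
    omega
  by_cases hlt : l = t
  · subst hlt
    rw [Equiv.swap_apply_right]
    simp only [Fin.lt_def] at *
    omega
  rw [Equiv.swap_apply_of_ne_of_ne hls hlt]

theorem apply_eq_apply_of_lt {α : Type*} [LT α] {u v : Equiv.Perm α} {k : α}
    (h : ∀ i < k, u⁻¹ i = v⁻¹ i) {l : α} (hl : u l < k) : v l = u l := by
  have hinv : l = v⁻¹ (u l) := by simpa using h _ hl
  exact Equiv.Perm.eq_inv_iff_eq.mp hinv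

/-- If `u` and `v` have the same odd diagram and agree on the positions of the values below `k`,
then between the positions of `k` in `u` and `v`, every position whose parity differs from that of
`v⁻¹ k` carries a value of `u` below `k`. -/
theorem apply_lt_of_oddDiagram_eq {n : ℕ} {u v : Equiv.Perm (Fin n)}
    (h : oddDiagram u = oddDiagram v) {k : Fin n} (hkmin : ∀ i < k, u⁻¹ i = v⁻¹ i)
    {c : Fin n} (hac : u⁻¹ k ≤ c) (hcb : c ≤ v⁻¹ k)
    (hpar : (c : ℕ) % 2 ≠ ((v⁻¹ k : Fin n) : ℕ) % 2) : u c < k := by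
  have hvb : v (v⁻¹ k) = k := by simp
  have hua : u (u⁻¹ k) = k := by simp
  have hne : c ≠ v⁻¹ k := fun hc => hpar (by rw [hc])
  have hvc : v c < k := by
    by_contra hc
    have hlt : k < v c := lt_of_le_of_ne (not_lt.mp hc) fun hk => hne (by simp [hk])
    have hmem : (c, v (v⁻¹ k)) ∈ oddDiagram v :=
      mem_oddDiagram_apply.mpr ⟨by rwa [hvb], lt_of_le_of_ne hcb hne, hpar⟩
    rw [← h, hvb, ← hua, mem_oddDiagram_apply] at hmem
    exact absurd hmem.2.1 (not_lt.mpr (by simpa using hac))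
  rwa [apply_eq_apply_of_lt (fun i hi => (hkmin i hi).symm) hvc]

/-- If `u` and `v` have the same odd diagram, then to the right of `v⁻¹ k` the positions of the
opposite parity carry no value of `u` strictly between `k` and `u (v⁻¹ k)`. -/
theorem le_apply_of_oddDiagram_eq {n : ℕ} {u v : Equiv.Perm (Fin n)}
    (h : oddDiagram u = oddDiagram v) {k d : Fin n} (hbd : v⁻¹ k < d)
    (hpar : (d : ℕ) % 2 ≠ ((v⁻¹ k : Fin n) : ℕ) % 2) (hkd : k < u d) : u (v⁻¹ k) ≤ u d := by
  by_contra hc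
  have hmem : (v⁻¹ k, u d) ∈ oddDiagram u :=
    mem_oddDiagram_apply.mpr ⟨not_le.mp hc, hbd, hpar.symm⟩
  rw [h] at hmem
  have : u d < v (v⁻¹ k) := hmem.1
  rw [show v (v⁻¹ k) = k by simp] at this
  exact absurd hkd this.not_gt

/-- The minimum of an odd diagram class is increasing on the positions between `u⁻¹ k` and `v⁻¹ k`
whose values lie between `k` and `u (v⁻¹ k)`. -/
theorem apply_lt_apply_of_minimal {n : ℕ} {u v : Equiv.Perm (Fin n)}
    (h : oddDiagram u = oddDiagram v)
    (hmin : ∀ w : Equiv.Perm (Fin n), oddDiagram w = oddDiagram u → bruhatLE u w)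
    {k : Fin n} (hkmin : ∀ i < k, u⁻¹ i = v⁻¹ i) {s t : Fin n} (hst : s < t)
    (has : u⁻¹ k ≤ s) (htb : t ≤ v⁻¹ k) (hks : k ≤ u s) (hsb : u s ≤ u (v⁻¹ k))
    (hkt : k ≤ u t) : u s < u t := by
  by_contra hc
  have hts : u t < u s := lt_of_le_of_ne (not_lt.mp hc) fun he => hst.ne' (u.injective he)
  have hpar : ∀ c, u⁻¹ k ≤ c → c ≤ v⁻¹ k → k ≤ u c →
      (c : ℕ) % 2 = ((v⁻¹ k : Fin n) : ℕ) % 2 := fun c hac hcb hkc => by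
    by_contra hp
    exact absurd (apply_lt_of_oddDiagram_eq h hkmin hac hcb hp) (not_lt.mpr hkc)
  have hps := hpar s has (hst.le.trans htb) hks
  have hpt := hpar t (has.trans hst.le) htb hkt
  have hu : u * Equiv.swap s t * Equiv.swap s t = u := by simp [mul_assoc]
  have hoff : ∀ c, c ≠ s → c ≠ t → (u * Equiv.swap s t) c = u c := fun c hs ht => by
    rw [Equiv.Perm.mul_apply, Equiv.swap_apply_of_ne_of_ne hs ht]
  have hs : (u * Equiv.swap s t) s = u t := by simp
  have ht : (u * Equiv.swap s t) t = u s := by simp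
  have hw : (u * Equiv.swap s t) s < (u * Equiv.swap s t) t := by rwa [hs, ht]
  have hD : oddDiagram u = oddDiagram (u * Equiv.swap s t) := by
    conv_lhs => rw [← hu]
    refine oddDiagram_mul_swap _ hst hw (hps.trans hpt.symm) ?_ ?_
    · intro c hsc hct hp
      rw [hs, hoff c hsc.ne' hct.ne]
      exact (apply_lt_of_oddDiagram_eq h hkmin (has.trans hsc.le) (hct.le.trans htb)
        (hpt ▸ hp)).trans_le hkt
    · intro d htd hp hlt
      rw [hs, hoff d (hst.trans htd).ne' htd.ne'] at hlt
      rw [ht, hoff d (hst.trans htd).ne' htd.ne']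
      have hkd : k < u d := hkt.trans_lt hlt
      rw [hpt] at hp
      rcases le_or_gt d (v⁻¹ k) with hdb | hbd
      · exact absurd (hpar d (has.trans (hst.trans htd).le) hdb hkd.le) hp
      · exact lt_of_le_of_ne (hsb.trans (le_apply_of_oddDiagram_eq h hbd hp hkd))
          fun he => (hst.trans htd).ne (u.injective he)
  have hle := hmin _ hD.symm
  exact not_bruhatLE_of_mul_swap _ hst hw (hu.symm ▸ hle)

/-- For `w` in `[u, v]`, the rank of `w` is strictly below that of `u` on any
cell `(p, q)` such that the positions from `p` to `w⁻¹ k` carry no value of `u` in `[k, q)`. -/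
theorem rankCount_lt_of_bruhat_between {n : ℕ} {u v w : Equiv.Perm (Fin n)} {k : Fin n}
    (hkmin : ∀ i < k, u⁻¹ i = v⁻¹ i) (huw : bruhatLE u w) (hwv : bruhatLE w v)
    {p q : ℕ} (hp : p ≤ ((w⁻¹ k : Fin n) : ℕ)) (hq : (k : ℕ) < q)
    (hnone : ∀ l : Fin n, p ≤ (l : ℕ) → l ≤ w⁻¹ k → k ≤ u l → q ≤ (u l : ℕ)) :
    rankCount w p q < rankCount u p q := by
  have huv : ∀ r, rankCount u r k = rankCount v r k := fun r => by
    refine rankCount_congr fun l _ => ⟨fun hl => ?_, fun hl => ?_⟩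
    · rwa [apply_eq_apply_of_lt hkmin hl]
    · rwa [apply_eq_apply_of_lt (fun i hi => (hkmin i hi).symm) hl]
  have huwk : ∀ r, rankCount u r k = rankCount w r k := fun r =>
    le_antisymm ((huv r).trans_le (rankCount_le_of_bruhatLE hwv r k))
      (rankCount_le_of_bruhatLE huw r k)
  have hu := rankCount_rectangle_eq u (p := p) (p' := (w⁻¹ k : Fin n) + 1) (q := k) (q' := q)
    (by omega) hq.le fun l hl hl' hk hlq =>
      absurd (hnone l hl (Fin.le_def.mpr (by omega)) hk) (not_le.mpr hlq)
  have hw := rankCount_rectangle_lt w (p := p) (p' := (w⁻¹ k : Fin n) + 1) (q := k) (q' := q)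
    (w⁻¹ k) hp (Nat.lt_succ_self _) (by simp) (by simpa using hq)
  have h1 := rankCount_le_of_bruhatLE huw ((w⁻¹ k : Fin n) + 1) q
  have h2 := huwk p
  have h3 := huwk ((w⁻¹ k : Fin n) + 1)
  omega

/-- With the standing setup, `uᵢ` is the minimum element of the block `[u,v]⁽ⁱ⁾`. -/
theorem ui_is_min_of_block {n : ℕ} (D : Set (Fin n × Fin n)) (u v : Equiv.Perm (Fin n))
    (hu : oddDiagram u = D) (hv : oddDiagram v = D) (hne : u ≠ v)
    (hint : ∀ w : Equiv.Perm (Fin n), oddDiagram w = D ↔ (bruhatLE u w ∧ bruhatLE w v))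
    (k : Fin n) (hk : u⁻¹ k ≠ v⁻¹ k) (hkmin : ∀ i : Fin n, i < k → u⁻¹ i = v⁻¹ i)
    (m : ℕ) (hm : 0 < m) (aseq : Fin m → Fin n) (hmono : StrictMono aseq)
    (hrange : ∀ i : Fin n, (∃ j : Fin m, aseq j = i) ↔
      (u⁻¹ k ≤ i ∧ i ≤ v⁻¹ k ∧ u (u⁻¹ k) ≤ u i ∧ u i ≤ u (v⁻¹ k)))
    (useq : Fin m → Equiv.Perm (Fin n))
    (huseq0 : useq ⟨0, hm⟩ = u)
    (huseqS : ∀ (i : ℕ) (h : i + 1 < m),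
      useq ⟨i + 1, h⟩ = useq ⟨i, Nat.lt_of_succ_lt h⟩ *
        Equiv.swap (aseq ⟨i, Nat.lt_of_succ_lt h⟩) (aseq ⟨i + 1, h⟩)) :
    ∀ j : Fin m,
      (bruhatLE u (useq j) ∧ bruhatLE (useq j) v ∧ (useq j)⁻¹ k = aseq j) ∧
      ∀ w : Equiv.Perm (Fin n), bruhatLE u w → bruhatLE w v → w⁻¹ k = aseq j →
        bruhatLE (useq j) w := by
  have h : oddDiagram u = oddDiagram v := hu.trans hv.symm
  have hmin : ∀ w : Equiv.Perm (Fin n), oddDiagram w = oddDiagram u → bruhatLE u w :=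
    fun w hw => ((hint w).mp (hw.trans hu)).1
  have huv : bruhatLE u v := ((hint v).mp hv).1
  have hua : u (u⁻¹ k) = k := by simp
  have hseq : ∀ j, u⁻¹ k ≤ aseq j ∧ aseq j ≤ v⁻¹ k ∧ k ≤ u (aseq j) ∧
      u (aseq j) ≤ u (v⁻¹ k) := fun j => by
    simpa only [hua] using (hrange (aseq j)).mp ⟨j, rfl⟩
  have ha0 : aseq ⟨0, hm⟩ = u⁻¹ k := by
    have h0 := hseq ⟨0, hm⟩
    obtain ⟨j, hj⟩ := (hrange (u⁻¹ k)).mpr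
      ⟨le_rfl, h0.1.trans h0.2.1, le_rfl, hua.trans_le (h0.2.2.1.trans h0.2.2.2)⟩
    refine le_antisymm ?_ h0.1
    rw [← hj]
    exact hmono.monotone (Fin.le_def.mpr (Nat.zero_le _))
  have key : ∀ (t : ℕ) (ht : t < m),
      useq ⟨t, ht⟩ (aseq ⟨t, ht⟩) = k ∧
      (∀ l, aseq ⟨t, ht⟩ < l → useq ⟨t, ht⟩ l = u l) ∧
      (∀ p q : ℕ, (aseq ⟨t, ht⟩ : ℕ) < p →
        rankCount (useq ⟨t, ht⟩) p q = rankCount u p q) ∧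
      bruhatLE u (useq ⟨t, ht⟩) ∧
      ∀ w, bruhatLE u w → bruhatLE w v → aseq ⟨t, ht⟩ ≤ w⁻¹ k → w⁻¹ k ≤ v⁻¹ k →
        ∀ p q, rankCount w p q ≤ rankCount (useq ⟨t, ht⟩) p q := by
    intro t
    induction t with
    | zero =>
      intro ht
      rw [huseq0, ha0]
      exact ⟨hua, fun _ _ => rfl, fun _ _ _ => rfl, Relation.ReflTransGen.refl,
        fun w huw _ _ _ => rankCount_le_of_bruhatLE huw⟩
    | succ t ih =>
      intro ht
      obtain ⟨hk', hoff, hrank, hle, hdom⟩ := ih (Nat.lt_of_succ_lt ht)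
      have hat : aseq ⟨t, Nat.lt_of_succ_lt ht⟩ < aseq ⟨t + 1, ht⟩ :=
        hmono (Fin.lt_def.mpr (Nat.lt_succ_self t))
      obtain ⟨hal, halb, hkl, hlb⟩ := hseq ⟨t + 1, ht⟩
      have hut := hoff _ hat
      have hasc : useq ⟨t, Nat.lt_of_succ_lt ht⟩ (aseq ⟨t, Nat.lt_of_succ_lt ht⟩) <
          useq ⟨t, Nat.lt_of_succ_lt ht⟩ (aseq ⟨t + 1, ht⟩) := by
        refine lt_of_le_of_ne ?_ fun he => hat.ne (Equiv.injective _ he)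
        rwa [hk', hut]
      have hswap := rankCount_mul_swap _ hat hasc
      rw [huseqS t ht]
      refine ⟨by simpa using hk', fun l hl => ?_, fun p q hp => ?_,
        hle.trans (bruhatLE_mul_swap _ hat hasc), fun w huw hwv haw hwb p q => ?_⟩
      · rw [Equiv.Perm.mul_apply, Equiv.swap_apply_of_ne_of_ne (hat.trans hl).ne' hl.ne']
        exact hoff l (hat.trans hl)
      · have := hswap p q
        rw [if_neg (by omega), add_zero] at this
        rw [this, hrank p q (lt_trans hat hp)]
      · have hpq := hswap p q
        have hd := hdom w huw hwv (hat.le.trans haw) hwb p q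
        rw [hk', hut] at hpq
        split_ifs at hpq with hbox
        · obtain ⟨hap, hpa, hkq, hqu⟩ := hbox
          have hlt : rankCount w p q < rankCount u p q := by
            refine rankCount_lt_of_bruhat_between hkmin huw hwv
              (hpa.trans haw) hkq fun l hpl hlw hkul => ?_
            by_contra hlq
            have hlu : u l < u (aseq ⟨t + 1, ht⟩) := Fin.lt_def.mpr (by omega)
            have hatl : aseq ⟨t, Nat.lt_of_succ_lt ht⟩ < l := Fin.lt_def.mpr (by omega)
            have hal' : u⁻¹ k ≤ l := (hseq _).1.trans hatl.le
            obtain ⟨r, rfl⟩ := (hrange l).mpr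
              ⟨hal', hlw.trans hwb, hua.trans_le hkul, hlu.le.trans hlb⟩
            have htr : (⟨t + 1, ht⟩ : Fin m) ≤ r :=
              Fin.le_def.mpr (Fin.lt_def.mp (hmono.lt_iff_lt.mp hatl))
            rcases htr.eq_or_lt with rfl | htr
            · exact lt_irrefl _ hlu
            · exact lt_asymm hlu (apply_lt_apply_of_minimal h hmin hkmin (hmono htr)
                hal (hlw.trans hwb) hkl hlb hkul)
          have := hrank p q hap
          omega
        · omega
  intro j
  obtain ⟨hkj, -, -, hle, hdom⟩ := key j j.2
  refine ⟨⟨hle, bruhatLE_of_rankCount_le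
    (hdom v huv Relation.ReflTransGen.refl (hseq j).2.1 le_rfl), ?_⟩, fun w huw hwv hwk =>
    bruhatLE_of_rankCount_le (hdom w huw hwv hwk.ge (hwk.trans_le (hseq j).2.1))⟩
  rw [Equiv.Perm.inv_eq_iff_eq]
  exact hkj.symm
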